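/- Let w ∈ ℝ⁴ with qw ≠ w and q²w ≠ w, and suppose 0 < β < α and 0 < B < C < A. If the angle ϕ₁ between w and q²w with respect to g̃ equals π/2 (i.e. g̃(w,q²w) = 0), then the angle ϕ between w and q²w with respect to g satisfies cos ϕ = −β/α, i.e. g(w,q²w)/g(w,w) = −β/α. -/

import Mathlib

open Matrix

/-- The 4×4 cyclic-shift (circulant) permutation matrix with first row (0,1,0,0). -/
def q : Matrix (Fin 4) (Fin 4) ℝ :=
  !![0,1,0,0; 0,0,1,0; 0,0,0,1; 1,0,0,0]

/-- The symmetric 4×4 circulant matrix with first row (A,B,C,B). -/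
def gMat (A B C : ℝ) : Matrix (Fin 4) (Fin 4) ℝ :=
  !![A,B,C,B; B,A,B,C; C,B,A,B; B,C,B,A]

/-- The bilinear form associated with a 4×4 matrix. -/
def bil (M : Matrix (Fin 4) (Fin 4) ℝ) (w v : Fin 4 → ℝ) : ℝ :=
  w ⬝ᵥ M.mulVec v

theorem q_sq_mul_q_sq : q ^ 2 * q ^ 2 = 1 := by
  ext i j
  fin_cases i <;> fin_cases j <;> simp [q, pow_two, Matrix.mul_apply, Fin.sum_univ_four]

theorem bil_add_smul_mul_q_sq (M : Matrix (Fin 4) (Fin 4) ℝ) (α β : ℝ) (w : Fin 4 → ℝ) :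
    bil (α • M + β • (M * q ^ 2)) w ((q ^ 2).mulVec w) =
      α * bil M w ((q ^ 2).mulVec w) + β * bil M w w := by
  have hM : (M * q ^ 2).mulVec ((q ^ 2).mulVec w) = M.mulVec w := by
    rw [mulVec_mulVec, Matrix.mul_assoc, q_sq_mul_q_sq, Matrix.mul_one]
  simp only [bil, add_mulVec, smul_mulVec, dotProduct_add, dotProduct_smul, smul_eq_mul, hM]

theorem bil_gMat_self (A B C : ℝ) (w : Fin 4 → ℝ) :
    bil (gMat A B C) w w =
      (A - C) * (w ⬝ᵥ w) + (C - B) * ((w 0 + w 2) ^ 2 + (w 1 + w 3) ^ 2) +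
        B * (w 0 + w 1 + w 2 + w 3) ^ 2 := by
  simp [bil, gMat, mulVec, dotProduct, Fin.sum_univ_four]
  ring

theorem bil_gMat_self_pos {A B C : ℝ} (hB : 0 ≤ B) (hBC : B ≤ C) (hCA : C < A)
    {w : Fin 4 → ℝ} (hw : w ≠ 0) : 0 < bil (gMat A B C) w w := by
  have hww : 0 < w ⬝ᵥ w :=
    (Finset.sum_nonneg fun i _ => mul_self_nonneg (w i)).lt_of_ne'
      fun h => hw (dotProduct_self_eq_zero.mp h)
  have hAC : 0 < A - C := sub_pos.mpr hCA
  have hCB : 0 ≤ C - B := sub_nonneg.mpr hBC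
  rw [bil_gMat_self]
  positivity


theorem stmt_11 (A B C α β : ℝ) (hβ : 0 < β) (hβα : β < α)
    (hB : 0 < B) (hBC : B < C) (hCA : C < A)
    (w : Fin 4 → ℝ) (hqw : q.mulVec w ≠ w) (hq2w : (q ^ 2).mulVec w ≠ w)
    (h : bil (α • gMat A B C + β • (gMat A B C * q ^ 2)) w ((q ^ 2).mulVec w) = 0) :
    bil (gMat A B C) w ((q ^ 2).mulVec w) / bil (gMat A B C) w w = -(β / α) := by
  have hw : w ≠ 0 := by
    rintro rfl
    exact hqw (mulVec_zero q)
  have hg := bil_gMat_self_pos hB.le hBC.le hCA hw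
  rw [bil_add_smul_mul_q_sq] at h
  rw [← neg_div, div_eq_div_iff hg.ne' (hβ.trans hβα).ne']
  linarith
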